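/- arXiv:math/0410311 — 2 statements merged into one kernel-verified Lean document; each statement's English description precedes it below -/
import Mathlib

section
/- Every closed symmetric reflexive relation S on the set R of rays of T'_m is measurable, i.e., K^S_{u,v,Λ}∈F for all finite Λ⊆V and all u,v∈Λ. -/
open MeasureTheory

namespace RCTree

abbrev Edge (m : ℕ) := Fin (m + 1) × List (Fin m)
abbrev V (m : ℕ) := Option (Edge m)
abbrev Ray (m : ℕ) := Fin (m + 1) × (ℕ → Fin m)
abbrev Config (m : ℕ) := Edge m → Bool

variable {m : ℕ}

/-- The vertex at the top (towards the root) of an edge. -/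
def parentV (e : Edge m) : V m :=
  if e.2 = [] then none else some (e.1, e.2.dropLast)

/-- The vertex at the bottom (away from the root) of an edge. -/
def childV (e : Edge m) : V m := some e

/-- The (undirected) edge `e` has endvertices `u` and `v`. -/
def EndsAt (e : Edge m) (u v : V m) : Prop :=
  (parentV e = u ∧ childV e = v) ∨ (parentV e = v ∧ childV e = u)

/-- The `n`-th edge of a ray from the root. -/
def rayEdge (ρ : Ray m) (n : ℕ) : Edge m := (ρ.1, List.ofFn fun k : Fin n => ρ.2 k)

/-- The `n`-th vertex of a ray from the root. -/
def rayVtx (ρ : Ray m) : ℕ → V m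
  | 0 => none
  | n + 1 => some (rayEdge ρ n)

def rayEdges (ρ : Ray m) : Set (Edge m) := Set.range (rayEdge ρ)

/-- The ray `ρ` passes through the vertex `v`. -/
def RayThrough (ρ : Ray m) (v : V m) : Prop := ∃ n, rayVtx ρ n = v

/-- All edges of the ray `ρ` are open in `ω`. -/
def OpenRay (ω : Config m) (ρ : Ray m) : Prop := ∀ n, ω (rayEdge ρ n) = true

/-- An infinite self-avoiding (undirected) path with endpoint `x`. -/
structure IPath (m : ℕ) (x : V m) where
  vtx : ℕ → V m
  start : vtx 0 = x
  inj : Function.Injective vtx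
  adj : ∀ n, ∃ e : Edge m, EndsAt e (vtx n) (vtx (n + 1))

/-- The edges traversed by an infinite path. -/
def IPath.edges {x : V m} (π : IPath m x) : Set (Edge m) :=
  {e | ∃ n, EndsAt e (π.vtx n) (π.vtx (n + 1))}

/-- A path is forward (an `x`-ray) if it is directed away from the root. -/
def IPath.Forward {x : V m} (π : IPath m x) : Prop :=
  ∀ n, ∃ e : Edge m, parentV e = π.vtx n ∧ childV e = π.vtx (n + 1)

/-- All edges of the path `π` are open in `ω`. -/
def OpenPath {x : V m} (ω : Config m) (π : IPath m x) : Prop :=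
  ∀ e ∈ π.edges, ω e = true

/-- The path `π` and the `0`-ray `ρ` differ in only finitely many edges:
`ρ` is the `0`-ray associated with `π`. -/
def Assoc {x : V m} (π : IPath m x) (ρ : Ray m) : Prop :=
  ((IPath.edges π \ rayEdges ρ) ∪ (rayEdges ρ \ IPath.edges π)).Finite

/-- The set of edges with both endvertices in `Λ`. -/
def ELam (Λ : Set (V m)) : Set (Edge m) :=
  {e | parentV e ∈ Λ ∧ childV e ∈ Λ}

/-- The event `K^S_{u,v,Λ}`: there exist vertex-disjoint open infinite paths from `u` and
from `v`, edge-disjoint from `E_Λ`, whose associated `0`-rays are `S`-related. -/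
def KEvent (S : Ray m → Ray m → Prop) (Λ : Set (V m)) (u v : V m) : Set (Config m) :=
  {ω | ∃ (πu : IPath m u) (πv : IPath m v),
      (∀ a b, πu.vtx a ≠ πv.vtx b) ∧
      OpenPath ω πu ∧ OpenPath ω πv ∧
      (∀ e ∈ πu.edges, e ∉ ELam Λ) ∧ (∀ e ∈ πv.edges, e ∉ ELam Λ) ∧
      ∃ ρu ρv : Ray m, Assoc πu ρu ∧ Assoc πv ρv ∧ S ρu ρv}

/-- The event `A^S_{u,v}`: there exist open `u`- and `v`-rays whose associated
`0`-rays are `S`-related. -/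
def AEvent (S : Ray m → Ray m → Prop) (u v : V m) : Set (Config m) :=
  {ω | ∃ (πu : IPath m u) (πv : IPath m v),
      πu.Forward ∧ πv.Forward ∧ OpenPath ω πu ∧ OpenPath ω πv ∧
      ∃ ρu ρv : Ray m, Assoc πu ρu ∧ Assoc πv ρv ∧ S ρu ρv}

/-- The event `A'^S_{u,v}`: there exist open `0`-rays through `u` and through `v`
that are `S`-related. -/
def APrimeEvent (S : Ray m → Ray m → Prop) (u v : V m) : Set (Config m) :=
  {ω | ∃ ρu ρv : Ray m, RayThrough ρu u ∧ RayThrough ρv v ∧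
      OpenRay ω ρu ∧ OpenRay ω ρv ∧ S ρu ρv}

/-- `u` lies on the (unique) path of the tree from the root to `v` (ancestor-or-equal). -/
def Anc : V m → V m → Prop
  | none, _ => True
  | some _, none => False
  | some e, some f => e.1 = f.1 ∧ e.2 <+: f.2

/-- Two vertices are comparable if one lies on the path from the root to the other. -/
def Comparable (u v : V m) : Prop := Anc u v ∨ Anc v u

/-- `W` is a cutset: it is incomparable (no ray contains more than one member of `W`)
and every ray contains some member of `W`. -/
def IsCutset (W : Set (V m)) : Prop :=
  (∀ (ρ : Ray m) (u v : V m), u ∈ W → v ∈ W → RayThrough ρ u → RayThrough ρ v → u = v) ∧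
  ∀ ρ : Ray m, ∃ v ∈ W, RayThrough ρ v

/-- The distance of a vertex from the root. -/
def depth : V m → ℕ
  | none => 0
  | some e => e.2.length + 1

/-- The edges on the path from the root to a vertex. -/
def rootEdges : V m → Set (Edge m)
  | none => ∅
  | some e => {f | f.1 = e.1 ∧ f.2 <+: e.2}

lemma depth_parentV (e : Edge m) : depth (parentV e) = e.2.length := by
  unfold parentV
  split_ifs with h
  · simp [depth, h]
  · have := List.length_pos_iff.2 h
    simp only [depth, List.length_dropLast]
    omega

lemma parentV_ne_some (e : Edge m) : parentV e ≠ some e := fun h => by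
  have := depth_parentV e
  rw [h] at this
  simp [depth] at this

lemma parentV_mk_nil (i : Fin (m + 1)) : parentV (i, ([] : List (Fin m))) = none := by
  simp [parentV]

lemma parentV_mk_concat (i : Fin (m + 1)) (l : List (Fin m)) (a : Fin m) :
    parentV (i, l ++ [a]) = some (i, l) := by
  simp [parentV]

lemma parentV_eq_none {e : Edge m} (h : parentV e = none) : e.2 = [] := by
  unfold parentV at h
  split_ifs at h with h'
  exact h'

lemma parentV_eq_some {e f : Edge m} (h : parentV e = some f) :
    ∃ a, e = (f.1, f.2 ++ [a]) := by
  unfold parentV at h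
  split_ifs at h with h'
  obtain rfl := Option.some.inj h
  exact ⟨e.2.getLast h', by simp [List.dropLast_append_getLast]⟩

lemma vertex_induction {P : V m → Prop} (root : P none)
    (step : ∀ e, P (parentV e) → P (some e)) (u : V m) : P u := by
  induction h : depth u generalizing u with
  | zero => cases u with
    | none => exact root
    | some e => simp [depth] at h
  | succ n ih => cases u with
    | none => exact root
    | some e => exact step e (ih _ (by rw [depth_parentV]; simpa [depth] using h))

lemma rootEdges_some (e : Edge m) : rootEdges (some e) = insert e (rootEdges (parentV e)) := by
  obtain ⟨i, l⟩ := e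
  induction l using List.reverseRecOn with
  | nil =>
    ext ⟨j, k⟩
    simp [rootEdges, parentV_mk_nil]
  | append_singleton l a _ =>
    ext ⟨j, k⟩
    rw [parentV_mk_concat]
    simp only [rootEdges, Set.mem_ofPred_eq, Set.mem_insert_iff, Prod.mk.injEq,
      List.prefix_concat_iff]
    tauto

lemma length_lt_depth {f : Edge m} {u : V m} (h : f ∈ rootEdges u) : f.2.length < depth u := by
  cases u with
  | none => exact h.elim
  | some e => exact Nat.lt_succ_of_le h.2.length_le

lemma notMem_rootEdges_parentV (e : Edge m) : e ∉ rootEdges (parentV e) := fun h => by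
  have := length_lt_depth h
  rw [depth_parentV] at this
  omega

lemma finite_rootEdges (u : V m) : (rootEdges u).Finite := by
  induction u using vertex_induction with
  | root => exact Set.finite_empty
  | step e ih => rw [rootEdges_some]; exact ih.insert e

lemma parentV_rayEdge (ρ : Ray m) (n : ℕ) : parentV (rayEdge ρ n) = rayVtx ρ n := by
  cases n with
  | zero => simp [rayEdge, rayVtx, parentV]
  | succ n =>
    rw [rayEdge, List.ofFn_succ', List.concat_eq_append, parentV_mk_concat]
    rfl

lemma depth_rayVtx (ρ : Ray m) (n : ℕ) : depth (rayVtx ρ n) = n := by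
  cases n <;> simp [rayVtx, rayEdge, depth]

lemma rayVtx_injective (ρ : Ray m) : Function.Injective (rayVtx ρ) := fun a b h => by
  rw [← depth_rayVtx ρ a, h, depth_rayVtx]

lemma rootEdges_rayVtx (ρ : Ray m) (n : ℕ) :
    rootEdges (rayVtx ρ n) = {f | ∃ k < n, rayEdge ρ k = f} := by
  induction n with
  | zero => simp [rayVtx, rootEdges]
  | succ n ih =>
    rw [rayVtx, rootEdges_some, parentV_rayEdge, ih]
    ext f
    simp only [Set.mem_insert_iff, Set.mem_ofPred_eq, Order.lt_add_one_iff]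
    constructor
    · rintro (rfl | ⟨k, hk, rfl⟩)
      exacts [⟨n, le_rfl, rfl⟩, ⟨k, hk.le, rfl⟩]
    · rintro ⟨k, hk, rfl⟩
      rcases hk.eq_or_lt with rfl | hk
      exacts [.inl rfl, .inr ⟨k, hk, rfl⟩]

lemma mem_rayEdges_iff {ρ : Ray m} {e : Edge m} :
    e ∈ rayEdges ρ ↔ rayEdge ρ e.2.length = e := by
  constructor
  · rintro ⟨n, rfl⟩
    simp [rayEdge]
  · exact fun h => ⟨_, h⟩

lemma parentV_mem_rayEdges {ρ : Ray m} {e f : Edge m} (hf : f ∈ rayEdges ρ)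
    (h : parentV f = some e) : e ∈ rayEdges ρ := by
  obtain ⟨n, rfl⟩ := hf
  rw [parentV_rayEdge] at h
  cases n with
  | zero => simp [rayVtx] at h
  | succ n => exact ⟨n, Option.some.inj h⟩

/-- Two rays sharing infinitely many edges are equal. -/
lemma ray_eq_of_finite_symmDiff {ρ σ : Ray m} (h : (symmDiff (rayEdges ρ) (rayEdges σ)).Finite) :
    ρ = σ := by
  have key : ∀ N, ∃ n ≥ N, rayEdge ρ n = rayEdge σ n := by
    intro N
    by_contra! hN
    refine Set.infinite_of_injective_forall_mem (f := fun k => rayEdge ρ (N + k)) ?_ ?_ h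
    · intro a b hab
      simpa [rayEdge] using congrArg (fun e : Edge m => e.2.length) hab
    · intro k
      refine Set.mem_symmDiff.2 (.inl ⟨⟨_, rfl⟩, fun hmem => hN (N + k) (by omega) ?_⟩)
      rw [mem_rayEdges_iff] at hmem
      simpa [rayEdge] using hmem.symm
  refine Prod.ext ?_ (funext fun k => ?_)
  · obtain ⟨n, -, hn⟩ := key 0
    exact (Prod.ext_iff.1 hn).1
  · obtain ⟨n, hk, hn⟩ := key (k + 1)
    exact congrFun (List.ofFn_injective (Prod.ext_iff.1 hn).2) ⟨k, hk⟩

lemma EndsAt.unique {e f : Edge m} {u v : V m} (he : EndsAt e u v) (hf : EndsAt f u v) :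
    e = f := by
  rcases he with ⟨h1, h2⟩ | ⟨h1, h2⟩ <;> rcases hf with ⟨h3, h4⟩ | ⟨h3, h4⟩
  · exact Option.some.inj (h2.trans h4.symm)
  · have h5 := depth_parentV e
    have h6 := depth_parentV f
    rw [h1, ← h4] at h5
    rw [h3, ← h2] at h6
    simp only [childV, depth] at h5 h6
    omega
  · have h5 := depth_parentV e
    have h6 := depth_parentV f
    rw [h1, ← h4] at h5
    rw [h3, ← h2] at h6
    simp only [childV, depth] at h5 h6
    omega
  · exact Option.some.inj (h2.trans h4.symm)

lemma EndsAt.eq_or_eq {e : Edge m} {u v : V m} (h : EndsAt e u v) (w : V m) :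
    (parentV e = w ∨ childV e = w) ↔ (u = w ∨ v = w) := by
  rcases h with ⟨rfl, rfl⟩ | ⟨rfl, rfl⟩
  exacts [Iff.rfl, or_comm]

lemma EndsAt.down_or_up {e : Edge m} {u v : V m} (h : EndsAt e u v) :
    (parentV e = u ∧ childV e = v) ∨ (u = some e ∧ v = parentV e) := by
  rcases h with h | ⟨h1, h2⟩
  exacts [.inl h, .inr ⟨h2.symm, h1.symm⟩]

namespace IPath

variable {x y : V m}

/-- The vertices of an infinite path are the endvertices of its edges. -/
lemma exists_vtx_eq_iff (π : IPath m x) (w : V m) :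
    (∃ n, π.vtx n = w) ↔ ∃ e ∈ π.edges, parentV e = w ∨ childV e = w := by
  constructor
  · rintro ⟨n, rfl⟩
    obtain ⟨e, he⟩ := π.adj n
    exact ⟨e, ⟨n, he⟩, (he.eq_or_eq _).2 (.inl rfl)⟩
  · rintro ⟨e, ⟨n, he⟩, hw⟩
    rcases (he.eq_or_eq _).1 hw with h | h
    exacts [⟨n, h⟩, ⟨n + 1, h⟩]

/-- Prepend an edge to an infinite path. -/
def cons (π : IPath m y) (x : V m) (e : Edge m) (h : EndsAt e x y) (hx : ∀ n, π.vtx n ≠ x) :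
    IPath m x where
  vtx n := n.casesOn x π.vtx
  start := rfl
  inj := by
    rintro (_ | a) (_ | b) hab
    · rfl
    · exact (hx b hab.symm).elim
    · exact (hx a hab).elim
    · exact congrArg _ (π.inj hab)
  adj := by
    rintro (_ | n)
    · exact ⟨e, by rw [← π.start] at h; exact h⟩
    · exact π.adj n

lemma edges_cons (π : IPath m y) (e : Edge m) (h : EndsAt e x y) (hx : ∀ n, π.vtx n ≠ x) :
    (π.cons x e h hx).edges = insert e π.edges := by
  have h0 : EndsAt e x (π.vtx 0) := by rwa [π.start]
  ext f
  constructor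
  · rintro ⟨_ | n, hf⟩
    · exact .inl (EndsAt.unique hf h0)
    · exact .inr ⟨n, hf⟩
  · rintro (rfl | ⟨n, hf⟩)
    exacts [⟨0, h0⟩, ⟨n + 1, hf⟩]

/-- Remove the first edge of an infinite path. -/
def tail (π : IPath m x) : IPath m (π.vtx 1) where
  vtx n := π.vtx (n + 1)
  start := rfl
  inj _ _ h := Nat.succ_injective (π.inj h)
  adj n := π.adj (n + 1)

lemma edges_eq_insert_tail (π : IPath m x) {e : Edge m} (h : EndsAt e x (π.vtx 1)) :
    π.edges = insert e π.tail.edges := by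
  have h0 : EndsAt e (π.vtx 0) (π.vtx 1) := by rwa [π.start]
  ext f
  constructor
  · rintro ⟨_ | n, hf⟩
    · exact .inl (hf.unique h0)
    · exact .inr ⟨n, hf⟩
  · rintro (rfl | ⟨n, hf⟩)
    exacts [⟨0, h0⟩, ⟨n + 1, hf⟩]

lemma notMem_edges (π : IPath m y) {e : Edge m} (h : EndsAt e x y) (hx : ∀ n, π.vtx n ≠ x) :
    e ∉ π.edges := fun he => by
  obtain ⟨n, hn⟩ := (π.exists_vtx_eq_iff x).2 ⟨e, he, (h.eq_or_eq x).2 (.inl rfl)⟩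
  exact hx n hn

/-- A path whose first step leads away from the root is forward. -/
lemma forward_of_first (π : IPath m x) {e : Edge m} (h : parentV e = π.vtx 0)
    (h' : childV e = π.vtx 1) : π.Forward := by
  intro n
  induction n with
  | zero => exact ⟨e, h, h'⟩
  | succ n ih =>
    obtain ⟨f, hf, hf'⟩ := ih
    obtain ⟨g, hg⟩ := π.adj (n + 1)
    rcases hg.down_or_up with hg | ⟨hg, hg'⟩
    · exact ⟨g, hg⟩
    · obtain rfl : f = g := Option.some.inj (hf'.trans hg)
      have := π.inj (hg'.trans hf)
      omega

lemma Forward.depth_vtx {π : IPath m x} (h : π.Forward) (n : ℕ) :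
    depth (π.vtx n) = depth x + n := by
  induction n with
  | zero => rw [π.start, add_zero]
  | succ n ih =>
    obtain ⟨e, he, he'⟩ := h n
    rw [← he, depth_parentV] at ih
    rw [← he', childV, depth, ih, add_assoc]

lemma Forward.exists_ray {π : IPath m none} (h : π.Forward) :
    ∃ ρ : Ray m, π.edges = rayEdges ρ := by
  choose e he he' using h
  have hstep : ∀ n, parentV (e (n + 1)) = some (e n) := fun n => (he (n + 1)).trans (he' n).symm
  choose a ha using fun n => parentV_eq_some (hstep n)
  refine ⟨((e 0).1, a), ?_⟩
  have hray : ∀ n, rayEdge ((e 0).1, a) n = e n := by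
    intro n
    induction n with
    | zero => exact Prod.ext rfl (parentV_eq_none ((he 0).trans π.start)).symm
    | succ n ih =>
      rw [ha n, ← ih]
      simp [rayEdge, List.ofFn_succ', -List.ofFn_succ]
  ext f
  constructor
  · rintro ⟨n, hf⟩
    exact ⟨n, (hray n).trans (EndsAt.unique (.inl ⟨he n, he' n⟩) hf)⟩
  · rintro ⟨n, rfl⟩
    rw [hray]
    exact ⟨n, .inl ⟨he n, he' n⟩⟩

/-- The edges of an infinite path from `u` are those of some `0`-ray, up to the path from the
root to `u`. -/
lemma exists_edges_eq {u : V m} (π : IPath m u) :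
    ∃ ρ : Ray m, π.edges = symmDiff (rootEdges u) (rayEdges ρ) := by
  induction u using vertex_induction with
  | root =>
    obtain ⟨e, he⟩ := π.adj 0
    have hd : parentV e = π.vtx 0 ∧ childV e = π.vtx 1 := by
      rcases he.down_or_up with h | ⟨h, -⟩
      · exact h
      · rw [π.start] at h
        simp at h
    obtain ⟨ρ, hρ⟩ := (π.forward_of_first hd.1 hd.2).exists_ray
    exact ⟨ρ, by simp [hρ, rootEdges, symmDiff_def]⟩
  | step e ih =>
    obtain ⟨f, hf⟩ := π.adj 0
    rcases hf.down_or_up with h | ⟨h, h'⟩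
    · have hfor := π.forward_of_first h.1 h.2
      have hx : ∀ n, π.vtx n ≠ parentV e := fun n hn => by
        have := hfor.depth_vtx n
        rw [hn, depth_parentV] at this
        simp only [depth] at this
        omega
      have hE : EndsAt e (parentV e) (some e) := .inl ⟨rfl, rfl⟩
      obtain ⟨ρ, hρ⟩ := ih (π.cons _ e hE hx)
      refine ⟨ρ, ?_⟩
      have hmem := π.notMem_edges hE hx
      have hnot := notMem_rootEdges_parentV e
      rw [edges_cons] at hρ
      rw [rootEdges_some]
      ext g
      have hg := Set.ext_iff.1 hρ g
      simp only [Set.mem_insert_iff, Set.mem_symmDiff] at hg ⊢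
      by_cases hge : g = e
      · subst hge
        tauto
      · tauto
    · obtain rfl : e = f := Option.some.inj (π.start.symm.trans h)
      have hE : EndsAt e (some e) (π.vtx 1) := .inr ⟨h'.symm, rfl⟩
      have hx : ∀ n, π.tail.vtx n ≠ some e := fun n hn => by
        have := π.inj (hn.trans π.start.symm)
        omega
      have hmem := π.tail.notMem_edges hE hx
      obtain ⟨ρ, hρ⟩ : ∃ ρ, π.tail.edges = symmDiff (rootEdges (parentV e)) (rayEdges ρ) := by
        have hgen : ∀ w (π' : IPath m w), w = parentV e →
            ∃ ρ, π'.edges = symmDiff (rootEdges (parentV e)) (rayEdges ρ) := by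
          rintro _ π' rfl
          exact ih π'
        exact hgen _ π.tail h'
      refine ⟨ρ, ?_⟩
      have hnot := notMem_rootEdges_parentV e
      rw [π.edges_eq_insert_tail hE, rootEdges_some]
      rw [hρ] at hmem ⊢
      ext g
      simp only [Set.mem_insert_iff, Set.mem_symmDiff] at hmem ⊢
      by_cases hge : g = e
      · subst hge
        tauto
      · tauto

/-- The tail of a `0`-ray started from its `n`-th vertex. -/
def ofRay (ρ : Ray m) (n : ℕ) : IPath m (rayVtx ρ n) where
  vtx k := rayVtx ρ (n + k)
  start := rfl
  inj _ _ h := Nat.add_left_cancel (rayVtx_injective ρ h)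
  adj k := ⟨rayEdge ρ (n + k), .inl ⟨parentV_rayEdge ρ _, rfl⟩⟩

lemma edges_ofRay (ρ : Ray m) (n : ℕ) :
    (ofRay ρ n).edges = symmDiff (rootEdges (rayVtx ρ n)) (rayEdges ρ) := by
  have hlen : ∀ k, (rayEdge ρ k).2.length = k := fun k => by simp [rayEdge]
  rw [rootEdges_rayVtx]
  ext f
  rw [Set.mem_symmDiff]
  constructor
  · rintro ⟨k, hk⟩
    obtain rfl := EndsAt.unique hk (.inl ⟨parentV_rayEdge ρ (n + k), rfl⟩)
    refine .inr ⟨⟨_, rfl⟩, ?_⟩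
    rintro ⟨j, hj, h⟩
    have := congrArg (fun e : Edge m => e.2.length) h
    simp only [hlen] at this
    omega
  · rintro (⟨⟨k, -, rfl⟩, h⟩ | ⟨⟨k, rfl⟩, h⟩)
    · exact (h ⟨k, rfl⟩).elim
    · obtain ⟨j, rfl⟩ : ∃ j, k = n + j := by
        refine Nat.exists_eq_add_of_le (not_lt.1 fun hk => h ⟨k, hk, rfl⟩)
      exact ⟨j, .inl ⟨parentV_rayEdge ρ _, rfl⟩⟩

/-- Every vertex is joined to every `0`-ray by an infinite path. -/
lemma exists_of_ray (u : V m) (ρ : Ray m) :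
    ∃ π : IPath m u, π.edges = symmDiff (rootEdges u) (rayEdges ρ) := by
  induction u using vertex_induction with
  | root => exact ⟨ofRay ρ 0, edges_ofRay ρ 0⟩
  | step e ih =>
    by_cases he : e ∈ rayEdges ρ
    · obtain ⟨n, rfl⟩ := he
      exact ⟨ofRay ρ (n + 1), edges_ofRay ρ (n + 1)⟩
    · obtain ⟨π, hπ⟩ := ih
      have hnot := notMem_rootEdges_parentV e
      have hE : EndsAt e (some e) (parentV e) := .inr ⟨rfl, rfl⟩
      have hx : ∀ n, π.vtx n ≠ some e := fun n hn => by
        obtain ⟨f, hf, h⟩ := (π.exists_vtx_eq_iff _).1 ⟨n, hn⟩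
        rw [hπ, Set.mem_symmDiff] at hf
        rcases h with h | h
        · rcases hf with ⟨hf, -⟩ | ⟨hf, -⟩
          · have h1 := length_lt_depth hf
            have h2 := depth_parentV f
            rw [depth_parentV] at h1
            rw [h] at h2
            simp only [depth] at h2
            omega
          · exact he (parentV_mem_rayEdges hf h)
        · obtain rfl := Option.some.inj h
          tauto
      refine ⟨π.cons _ e hE hx, ?_⟩
      rw [edges_cons, rootEdges_some, hπ]
      ext g
      simp only [Set.mem_insert_iff, Set.mem_symmDiff]
      by_cases hge : g = e
      · subst hge
        tauto
      · tauto

lemma assoc_iff {u : V m} (π : IPath m u) (ρ : Ray m) :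
    Assoc π ρ ↔ π.edges = symmDiff (rootEdges u) (rayEdges ρ) := by
  constructor
  · intro h
    obtain ⟨σ, hσ⟩ := π.exists_edges_eq
    have hfin : (symmDiff (rayEdges ρ) (rayEdges σ)).Finite := by
      refine (h.union (finite_rootEdges u)).subset fun e he => ?_
      have h1 := Set.ext_iff.1 hσ e
      simp only [Set.mem_symmDiff, Set.mem_union, Set.mem_sdiff] at he h1 ⊢
      tauto
    rwa [ray_eq_of_finite_symmDiff hfin]
  · intro h
    refine (finite_rootEdges u).subset fun e he => ?_
    have h1 := Set.ext_iff.1 h e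
    simp only [Set.mem_symmDiff, Set.mem_union, Set.mem_sdiff] at he h1 ⊢
    tauto

end IPath

lemma isClopen_mem_rayEdges (e : Edge m) : IsClopen {ρ : Ray m | e ∈ rayEdges ρ} := by
  have h : {ρ : Ray m | e ∈ rayEdges ρ} =
      {ρ | ρ.1 = e.1} ∩ ⋂ k : Fin e.2.length, {ρ | ρ.2 k = e.2.get k} := by
    ext ρ
    simp only [Set.mem_ofPred_eq, mem_rayEdges_iff, rayEdge, Set.mem_inter_iff, Set.mem_iInter]
    constructor
    · intro h
      refine ⟨congrArg Prod.fst h, fun k => ?_⟩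
      have h2 : List.ofFn (fun k : Fin e.2.length => ρ.2 k) = List.ofFn e.2.get :=
        (congrArg Prod.snd h).trans (List.ofFn_get _).symm
      exact congrFun (List.ofFn_injective h2) k
    · rintro ⟨h1, h2⟩
      refine Prod.ext h1 ?_
      rw [funext h2, List.ofFn_get]
  rw [h]
  refine IsClopen.inter ((isClopen_discrete {e.1}).preimage continuous_fst)
    (isClopen_iInter_of_finite fun k => ?_)
  exact (isClopen_discrete {e.2.get k}).preimage
    (f := fun ρ : Ray m => ρ.2 k) ((continuous_apply _).comp continuous_snd)

lemma isClopen_mem_symmDiff_rayEdges (u : V m) (e : Edge m) :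
    IsClopen {ρ : Ray m | e ∈ symmDiff (rootEdges u) (rayEdges ρ)} := by
  by_cases he : e ∈ rootEdges u
  · simpa [Set.mem_symmDiff, he, Set.compl_ofPred] using (isClopen_mem_rayEdges e).compl
  · simpa [Set.mem_symmDiff, he] using isClopen_mem_rayEdges e

/-- The event `K^S_{u,v,Λ}` in terms of the `0`-rays associated with the two paths. -/
lemma mem_KEvent_iff (S : Ray m → Ray m → Prop) (Λ : Set (V m)) (u v : V m) (ω : Config m) :
    ω ∈ KEvent S Λ u v ↔ ∃ ρ : Ray m × Ray m, S ρ.1 ρ.2 ∧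
      (∀ e, e ∈ symmDiff (rootEdges u) (rayEdges ρ.1) → ω e = true ∧ e ∉ ELam Λ) ∧
      (∀ e, e ∈ symmDiff (rootEdges v) (rayEdges ρ.2) → ω e = true ∧ e ∉ ELam Λ) ∧
      ∀ e f, e ∈ symmDiff (rootEdges u) (rayEdges ρ.1) →
        f ∈ symmDiff (rootEdges v) (rayEdges ρ.2) →
        ∀ w, (parentV e = w ∨ childV e = w) → ¬(parentV f = w ∨ childV f = w) := by
  constructor
  · rintro ⟨πu, πv, hdisj, hou, hov, hLu, hLv, ρu, ρv, hau, hav, hS⟩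
    rw [IPath.assoc_iff] at hau hav
    refine ⟨(ρu, ρv), hS, ?_⟩
    simp only [← hau, ← hav]
    refine ⟨fun e he => ⟨hou e he, hLu e he⟩, fun e he => ⟨hov e he, hLv e he⟩, ?_⟩
    intro e f he hf w hew hfw
    obtain ⟨a, ha⟩ := (πu.exists_vtx_eq_iff w).2 ⟨e, he, hew⟩
    obtain ⟨b, hb⟩ := (πv.exists_vtx_eq_iff w).2 ⟨f, hf, hfw⟩
    exact hdisj a b (ha.trans hb.symm)
  · rintro ⟨⟨ρu, ρv⟩, hS, hu, hv, hdisj⟩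
    obtain ⟨πu, hπu⟩ := IPath.exists_of_ray u ρu
    obtain ⟨πv, hπv⟩ := IPath.exists_of_ray v ρv
    simp only [← hπu, ← hπv] at hu hv hdisj
    refine ⟨πu, πv, fun a b hab => ?_, fun e he => (hu e he).1, fun e he => (hv e he).1,
      fun e he => (hu e he).2, fun e he => (hv e he).2, ρu, ρv, (πu.assoc_iff ρu).2 hπu,
      (πv.assoc_iff ρv).2 hπv, hS⟩
    obtain ⟨e, he, hew⟩ := (πu.exists_vtx_eq_iff _).1 ⟨a, rfl⟩
    obtain ⟨f, hf, hfw⟩ := (πv.exists_vtx_eq_iff _).1 ⟨b, hab.symm⟩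
    exact hdisj e f he hf _ hew hfw

/-- For a closed relation `S`, the event `K^S_{u,v,Λ}` is closed in the product topology. -/
lemma isClosed_KEvent {S : Ray m → Ray m → Prop}
    (hclosed : IsClosed {x : Ray m × Ray m | S x.1 x.2}) (Λ : Set (V m)) (u v : V m) :
    IsClosed (KEvent S Λ u v) := by
  let C : Set (Config m × (Ray m × Ray m)) := {x | S x.2.1 x.2.2 ∧
      (∀ e, e ∈ symmDiff (rootEdges u) (rayEdges x.2.1) → x.1 e = true ∧ e ∉ ELam Λ) ∧
      (∀ e, e ∈ symmDiff (rootEdges v) (rayEdges x.2.2) → x.1 e = true ∧ e ∉ ELam Λ) ∧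
      ∀ e f, e ∈ symmDiff (rootEdges u) (rayEdges x.2.1) →
        f ∈ symmDiff (rootEdges v) (rayEdges x.2.2) →
        ∀ w, (parentV e = w ∨ childV e = w) → ¬(parentV f = w ∨ childV f = w)}
  have hC : KEvent S Λ u v = Prod.fst '' C := by
    ext ω
    rw [mem_KEvent_iff]
    constructor
    · rintro ⟨ρ, h⟩
      exact ⟨(ω, ρ), h, rfl⟩
    · rintro ⟨⟨ω', ρ⟩, h, rfl⟩
      exact ⟨ρ, h⟩
  rw [hC]
  refine isClosedMap_fst_of_compactSpace C ?_
  have hu (e : Edge m) : IsOpen {x : Config m × (Ray m × Ray m) |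
      e ∈ symmDiff (rootEdges u) (rayEdges x.2.1)} :=
    (isClopen_mem_symmDiff_rayEdges u e).isOpen.preimage (continuous_fst.comp continuous_snd)
  have hv (e : Edge m) : IsOpen {x : Config m × (Ray m × Ray m) |
      e ∈ symmDiff (rootEdges v) (rayEdges x.2.2)} :=
    (isClopen_mem_symmDiff_rayEdges v e).isOpen.preimage (continuous_snd.comp continuous_snd)
  have hω (e : Edge m) : IsClosed {x : Config m × (Ray m × Ray m) |
      x.1 e = true ∧ e ∉ ELam Λ} :=
    (isClosed_eq ((continuous_apply e).comp continuous_fst) continuous_const).inter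
      isClosed_const
  have hpath {p : Edge m → Config m × (Ray m × Ray m) → Prop} (hp : ∀ e, IsOpen {x | p e x}) :
      IsClosed {x | ∀ e, p e x → x.1 e = true ∧ e ∉ ELam Λ} := by
    rw [Set.ofPred_forall]
    exact isClosed_iInter fun e => isClosed_imp (hp e) (hω e)
  have hdisj : IsClosed {x : Config m × (Ray m × Ray m) |
      ∀ e f, e ∈ symmDiff (rootEdges u) (rayEdges x.2.1) →
        f ∈ symmDiff (rootEdges v) (rayEdges x.2.2) →
        ∀ w, (parentV e = w ∨ childV e = w) → ¬(parentV f = w ∨ childV f = w)} := by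
    rw [Set.ofPred_forall]
    refine isClosed_iInter fun e => ?_
    rw [Set.ofPred_forall]
    exact isClosed_iInter fun f => isClosed_imp (hu e) (isClosed_imp (hv f) isClosed_const)
  exact (hclosed.preimage continuous_snd).inter ((hpath hu).inter ((hpath hv).inter hdisj))

/-- Every closed symmetric reflexive relation on the set of rays of `T'_m`
is measurable: all the events `K^S_{u,v,Λ}` belong to the product σ-field. -/
theorem closed_rel_measurable (m : ℕ) (hm : 2 ≤ m) (S : Ray m → Ray m → Prop)
    (hrefl : ∀ ρ, S ρ ρ) (hsymm : ∀ ρ₁ ρ₂, S ρ₁ ρ₂ → S ρ₂ ρ₁)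
    (hclosed : IsClosed {x : Ray m × Ray m | S x.1 x.2}) :
    ∀ Λ : Set (V m), Λ.Finite → ∀ u ∈ Λ, ∀ v ∈ Λ, MeasurableSet (KEvent S Λ u v) := by
  intro Λ _ u _ v _
  exact (isClosed_KEvent hclosed Λ u v).measurableSet

end RCTree
end

section
/- Let ∼ be an equivalence relation on the set R of rays of T'_m, and for k≥1 let R(k) be the set of paths of length k starting at 0. The following are equivalent: (a) ∼ is an open subset of R×R; (b) each equivalence class of ∼ is an open subset of R; (c) there exist an integer k≥1 and an equivalence relation ∼_k on R(k) such that for all rays ρ_1,ρ_2: ρ_1∼ρ_2 if and only if ρ_1(k) ∼_k ρ_2(k), where ρ(k) denotes the path comprising the first k edges of ρ. -/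
open MeasureTheory

namespace RCTree

variable {m : ℕ}

theorem rayEdge_eq_iff {ρ ρ' : Ray m} {n : ℕ} :
    rayEdge ρ n = rayEdge ρ' n ↔ ρ.1 = ρ'.1 ∧ ∀ i < n, ρ.2 i = ρ'.2 i := by
  simp only [rayEdge, Prod.mk.injEq, List.ofFn_inj, funext_iff, Fin.forall_iff]

theorem isLocallyConstant_rayEdge (n : ℕ) :
    IsLocallyConstant fun ρ : Ray m => rayEdge ρ n := by
  have h : IsLocallyConstant fun ρ : Ray m => (ρ.1, fun k : Fin n => ρ.2 k) :=
    (IsLocallyConstant.iff_continuous _).2 (by fun_prop)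
  exact h.comp fun p => (p.1, List.ofFn p.2)

/-- Rays sharing sufficiently many edges with `ρ` lie in a given neighbourhood of `ρ`. -/
theorem exists_rayEdge_subset_of_isOpen {U : Set (Ray m)} (hU : IsOpen U) {ρ : Ray m}
    (hρ : ρ ∈ U) : ∃ n, ∀ ρ', rayEdge ρ' n = rayEdge ρ n → ρ' ∈ U := by
  have hV : IsOpen {x : ℕ → Fin m | (ρ.1, x) ∈ U} := hU.preimage (by fun_prop)
  obtain ⟨I, u, hu, hsub⟩ := isOpen_pi_iff.1 hV ρ.2 hρ
  refine ⟨I.sup id + 1, fun ρ' h => ?_⟩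
  obtain ⟨h₁, h₂⟩ := rayEdge_eq_iff.1 h
  have hmem : ρ'.2 ∈ (I : Set ℕ).pi u := fun i hi => by
    rw [h₂ i (Nat.lt_succ_of_le (Finset.le_sup (f := id) hi))]
    exact (hu i hi).2
  have := hsub hmem
  rwa [Set.mem_ofPred_eq, ← h₁] at this

/-- If all classes of `S` are open, a uniform number of initial edges determines the class. -/
theorem exists_rayEdge_eq_imp_of_isOpen {S : Ray m → Ray m → Prop} (hS : Equivalence S)
    (h : ∀ ρ, IsOpen {ρ' | S ρ ρ'}) :
    ∃ n, ∀ ρ ρ', rayEdge ρ' n = rayEdge ρ n → S ρ ρ' := by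
  let U : ℕ → Set (Ray m) := fun n => {ρ | ∀ ρ', rayEdge ρ' n = rayEdge ρ n → S ρ ρ'}
  have hUo (n : ℕ) : IsOpen (U n) := by
    rw [isOpen_iff_mem_nhds]
    intro ρ hρ
    filter_upwards [(isLocallyConstant_rayEdge n).eventually_eq ρ] with σ hσ ρ' h'
    exact hS.trans (hS.symm (hρ σ hσ)) (hρ ρ' (h'.trans hσ))
  have hUm : Monotone U := fun a b hab ρ hρ ρ' h' => by
    obtain ⟨h₁, h₂⟩ := rayEdge_eq_iff.1 h'
    exact hρ ρ' (rayEdge_eq_iff.2 ⟨h₁, fun i hi => h₂ i (hi.trans_le hab)⟩)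
  obtain ⟨n, hn⟩ := isCompact_univ.elim_directed_cover U hUo
    (fun ρ _ => Set.mem_iUnion.2 (exists_rayEdge_subset_of_isOpen (h ρ) (hS.refl ρ)))
    hUm.directed_le
  exact ⟨n, fun ρ => hn (Set.mem_univ ρ)⟩

/-- For an equivalence relation `∼` on the set of rays of `T'_m`, the
following are equivalent: (a) `∼` is open in `R × R`; (b) every equivalence class is open;
(c) `∼` is determined by the first `k` edges (encoded by `rayEdge ρ (k-1)`), for some `k ≥ 1`,
via an equivalence relation `∼_k` on the paths of length `k` from the root. -/
theorem open_equiv_tfae (m : ℕ) (hm : 2 ≤ m) (S : Ray m → Ray m → Prop)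
    (hS : Equivalence S) :
    List.TFAE
      [IsOpen {x : Ray m × Ray m | S x.1 x.2},
       ∀ ρ : Ray m, IsOpen {ρ' : Ray m | S ρ ρ'},
       ∃ k : ℕ, 1 ≤ k ∧ ∃ Sk : Edge m → Edge m → Prop, Equivalence Sk ∧
         ∀ ρ₁ ρ₂ : Ray m, S ρ₁ ρ₂ ↔ Sk (rayEdge ρ₁ (k - 1)) (rayEdge ρ₂ (k - 1))] := by
  tfae_have 1 → 2 := fun h ρ => h.preimage (Continuous.prodMk_right ρ)
  tfae_have 2 → 3 := by
    intro h
    obtain ⟨n, hn⟩ := exists_rayEdge_eq_imp_of_isOpen hS h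
    refine ⟨n + 1, n.succ_pos, fun e f => e = f ∨
      ∃ ρ₁ ρ₂, rayEdge ρ₁ n = e ∧ rayEdge ρ₂ n = f ∧ S ρ₁ ρ₂, ⟨fun e => .inl rfl, ?_, ?_⟩, ?_⟩
    · rintro e f (rfl | ⟨ρ₁, ρ₂, h₁, h₂, h₁₂⟩)
      · exact .inl rfl
      · exact .inr ⟨ρ₂, ρ₁, h₂, h₁, hS.symm h₁₂⟩
    · rintro e f g (rfl | ⟨ρ₁, ρ₂, h₁, h₂, h₁₂⟩) (rfl | ⟨ρ₃, ρ₄, h₃, h₄, h₃₄⟩)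
      · exact .inl rfl
      · exact .inr ⟨ρ₃, ρ₄, h₃, h₄, h₃₄⟩
      · exact .inr ⟨ρ₁, ρ₂, h₁, h₂, h₁₂⟩
      · exact .inr ⟨ρ₁, ρ₄, h₁, h₄, hS.trans h₁₂ (hS.trans (hn ρ₂ ρ₃ (h₃.trans h₂.symm)) h₃₄)⟩
    · intro ρ₁ ρ₂
      refine ⟨fun h₁₂ => .inr ⟨ρ₁, ρ₂, rfl, rfl, h₁₂⟩, ?_⟩
      rintro (h₁₂ | ⟨σ₁, σ₂, h₁, h₂, h₁₂⟩)
      · exact hn ρ₁ ρ₂ h₁₂.symm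
      · exact hS.trans (hn ρ₁ σ₁ h₁) (hS.trans h₁₂ (hS.symm (hn ρ₂ σ₂ h₂)))
  tfae_have 3 → 1 := by
    rintro ⟨k, -, Sk, -, hSk⟩
    simp only [hSk]
    have hfst := (isLocallyConstant_rayEdge (m := m) (k - 1)).comp_continuous
      (continuous_fst (X := Ray m) (Y := Ray m))
    have hsnd := (isLocallyConstant_rayEdge (m := m) (k - 1)).comp_continuous
      (continuous_snd (X := Ray m) (Y := Ray m))
    exact (hfst.prodMk hsnd) {p | Sk p.1 p.2}
  tfae_finish

end RCTree
end
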